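/- arXiv:1904.06113 — 2 statements merged into one kernel-verified Lean document; each statement's English description precedes it below -/
import Mathlib

section
/- Let H be a real inner product space with norm ‖·‖, let γ > 0, Δt > 0 with γ·Δt ≤ 24, let C ≥ 0, and let (e_n)_{n≥0} be a sequence in H. For n ≥ 1 set G_n = (1/4)‖e_n‖² + (1/4)‖2e_n − e_{n-1}‖², and assume that for all n ≥ 2, G_n − G_{n-1} + (γΔt/2)·‖e_n‖² ≤ Δt·C/2. Then for all n ≥ 1, ‖e_n‖² ≤ 4·(1 + γΔt/12)^{−(n−1)}·( 2(‖e_1‖² + ‖e_0‖²) + (γΔt/8)‖e_1‖² ) + 72·C/γ. -/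
/-- Discrete Gronwall-type recursion: damping by the factor `1 + t` with a constant source. -/
theorem le_zpow_neg_mul_add_of_damped_recursion {t K : ℝ} (ht : 0 < t) (hK : 0 ≤ K) {L : ℕ → ℝ}
    (hL : ∀ k, (1 + t) * L (k + 1) ≤ L k + t * K) (k : ℕ) :
    L k ≤ (1 + t) ^ (-(k : ℤ)) * L 0 + K := by
  have hpos : 0 < 1 + t := by linarith
  induction k with
  | zero => simpa using hK
  | succ k ih =>
    refine le_of_mul_le_mul_left ?_ hpos
    have hpow : (1 + t) * (1 + t) ^ (-((k + 1 : ℕ) : ℤ)) = (1 + t) ^ (-(k : ℤ)) := by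
      rw [← zpow_one_add₀ hpos.ne']
      congr 1
      push_cast
      ring
    rw [mul_add, ← mul_assoc, hpow]
    linarith [hL k]

/-- The upper equivalence bound for the `G`-norm of the BDF2 method. -/
theorem bdf2_gNorm_sq_le {H : Type*} [SeminormedAddCommGroup H] [NormedSpace ℝ H] (x y : H) :
    (1 / 4) * ‖x‖ ^ 2 + (1 / 4) * ‖(2 : ℝ) • x - y‖ ^ 2 ≤ 3 / 2 * (‖x‖ ^ 2 + ‖y‖ ^ 2) := by
  have h : ‖(2 : ℝ) • x - y‖ ≤ 2 * ‖x‖ + ‖y‖ := by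
    simpa [norm_smul] using norm_sub_le ((2 : ℝ) • x) y
  have hsq : ‖(2 : ℝ) • x - y‖ ^ 2 ≤ (2 * ‖x‖ + ‖y‖) ^ 2 := by gcongr
  nlinarith [sq_nonneg (‖x‖ - 2 * ‖y‖), sq_nonneg ‖y‖]


/-- Uniform-in-time decay estimate underlying the implicit BDF2 error bound:
with `G_n = (1/4)‖e_n‖² + (1/4)‖2e_n − e_{n-1}‖²`, if
`G_n − G_{n-1} + (γΔt/2)‖e_n‖² ≤ ΔtC/2` for all `n ≥ 2`, then for all `n ≥ 1`,
`‖e_n‖² ≤ 4(1 + γΔt/12)^{−(n−1)}(2(‖e_1‖² + ‖e_0‖²) + (γΔt/8)‖e_1‖²) + 72C/γ`. -/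
theorem stmt_5 {H : Type*} [NormedAddCommGroup H] [InnerProductSpace ℝ H]
    (γ Δt C : ℝ) (hγ : 0 < γ) (hΔt : 0 < Δt) (hγΔt : γ * Δt ≤ 24) (hC : 0 ≤ C)
    (e : ℕ → H)
    (hrec : ∀ n : ℕ, 2 ≤ n →
      ((1 / 4) * ‖e n‖ ^ 2 + (1 / 4) * ‖(2 : ℝ) • e n - e (n - 1)‖ ^ 2)
          - ((1 / 4) * ‖e (n - 1)‖ ^ 2 + (1 / 4) * ‖(2 : ℝ) • e (n - 1) - e (n - 2)‖ ^ 2)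
          + (γ * Δt / 2) * ‖e n‖ ^ 2 ≤ Δt * C / 2) :
    ∀ n : ℕ, 1 ≤ n →
      ‖e n‖ ^ 2 ≤
        4 * (1 + γ * Δt / 12) ^ (-((n : ℤ) - 1)) *
            (2 * (‖e 1‖ ^ 2 + ‖e 0‖ ^ 2) + (γ * Δt / 8) * ‖e 1‖ ^ 2)
          + 72 * C / γ := by
  set s := γ * Δt with hs
  have hs0 : 0 < s := mul_pos hγ hΔt
  have hK : 0 ≤ C / γ := by positivity
  have hsource : s * (C / γ) = Δt * C := by rw [hs]; field_simp
  let L : ℕ → ℝ := fun k =>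
    (1 / 4) * ‖e (k + 1)‖ ^ 2 + (1 / 4) * ‖(2 : ℝ) • e (k + 1) - e k‖ ^ 2
      + s / 8 * ‖e (k + 1)‖ ^ 2
  have hL : ∀ k, (1 + s / 12) * L (k + 1) ≤ L k + s / 12 * (6 * (C / γ)) := by
    intro k
    have hstep := hrec (k + 2) (by omega)
    rw [show k + 2 - 1 = k + 1 by omega, show k + 2 - 2 = k by omega] at hstep
    have hG := mul_le_mul_of_nonneg_left (bdf2_gNorm_sq_le (e (k + 2)) (e (k + 1))) hs0.le
    have hdamp : s * (s * ‖e (k + 2)‖ ^ 2) ≤ 24 * (s * ‖e (k + 2)‖ ^ 2) := by gcongr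
    simp only [L]
    linarith
  intro n hn
  obtain ⟨k, rfl⟩ : ∃ k, n = k + 1 := ⟨n - 1, by omega⟩
  have hdecay := le_zpow_neg_mul_add_of_damped_recursion (by positivity) (by positivity) hL k
  have hinit : L 0 ≤ 2 * (‖e 1‖ ^ 2 + ‖e 0‖ ^ 2) + s / 8 * ‖e 1‖ ^ 2 := by
    have h := bdf2_gNorm_sq_le (e 1) (e 0)
    simp only [L, zero_add]
    linarith [sq_nonneg ‖e 1‖, sq_nonneg ‖e 0‖]
  have hpow : (0 : ℝ) ≤ (1 + s / 12) ^ (-(k : ℤ)) := by positivity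
  have hmul := mul_le_mul_of_nonneg_left hinit hpow
  have hlower : (1 / 4) * ‖e (k + 1)‖ ^ 2 ≤ L k := by
    have h1 : 0 ≤ (1 / 4) * ‖(2 : ℝ) • e (k + 1) - e k‖ ^ 2 := by positivity
    have h2 : 0 ≤ s / 8 * ‖e (k + 1)‖ ^ 2 := by positivity
    simp only [L]
    linarith
  rw [show -(((k + 1 : ℕ) : ℤ) - 1) = -(k : ℤ) by push_cast; ring, mul_div_assoc 72, mul_assoc 4]
  linarith
end

section
/- Let X be a real normed vector space, let u : ℝ → X be three times differentiable, let Δt > 0 and t ∈ ℝ, and suppose ‖u'''(s)‖ ≤ M for all s ∈ [t − 2Δt, t]. Then the BDF2 difference quotient satisfies the truncation error bound ‖u'(t) − (3u(t) − 4u(t − Δt) + u(t − 2Δt))/(2Δt)‖ ≤ M·(Δt)². -/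
open Set in
/-- If `f 0 = 0` and `‖f'(s)‖ ≤ C s ^ n` on `[0, b]`, then `‖f s‖ ≤ C s ^ (n + 1) / (n + 1)`
there. -/
theorem norm_le_pow_succ_of_norm_deriv_le_pow {E : Type*} [NormedAddCommGroup E]
    [NormedSpace ℝ E] {f f' : ℝ → E} {b C : ℝ} {n : ℕ} (h0 : f 0 = 0)
    (hf : ∀ s, HasDerivAt f (f' s) s) (bound : ∀ s ∈ Icc 0 b, ‖f' s‖ ≤ C * s ^ n) :
    ∀ s ∈ Icc 0 b, ‖f s‖ ≤ C / (n + 1) * s ^ (n + 1) := by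
  have hB : ∀ s : ℝ, HasDerivAt (fun s : ℝ => C / (n + 1) * s ^ (n + 1)) (C * s ^ n) s := by
    intro s
    refine ((hasDerivAt_pow (n + 1) s).const_mul (C / (n + 1))).congr_deriv ?_
    have : (n : ℝ) + 1 ≠ 0 := by positivity
    push_cast
    field_simp
  intro s hs
  exact image_norm_le_of_norm_deriv_right_le_deriv_boundary
    (fun x _ => (hf x).continuousAt.continuousWithinAt)
    (fun x _ => (hf x).hasDerivWithinAt) (by simp [h0]) hB
    (fun x hx => bound x (Ico_subset_Icc_self hx)) hs

open Set in
/-- Second-order backward Taylor expansion with a bound on the remainder. -/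
theorem norm_backward_taylor_two_le {X : Type*} [NormedAddCommGroup X] [NormedSpace ℝ X]
    {u : ℝ → X} (hu : Differentiable ℝ u) (hu' : Differentiable ℝ (deriv u))
    (hu'' : Differentiable ℝ (deriv (deriv u))) {b t M : ℝ}
    (hM : ∀ s ∈ Icc (t - b) t, ‖deriv (deriv (deriv u)) s‖ ≤ M) :
    ∀ s ∈ Icc 0 b,
      ‖u (t - s) - u t + s • deriv u t - (s ^ 2 / 2) • deriv (deriv u) t‖ ≤ M / 6 * s ^ 3 := by
  have hcomp : ∀ {v : ℝ → X}, Differentiable ℝ v → ∀ s,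
      HasDerivAt (fun s => v (t - s)) (-deriv v (t - s)) s := fun hv s =>
    (hv (t - s)).hasDerivAt.comp_const_sub t s
  have hid : ∀ (c : X) (s : ℝ), HasDerivAt (fun s : ℝ => s • c) c s := fun c s => by
    simpa using (hasDerivAt_id s).smul_const c
  have hsq : ∀ (c : X) (s : ℝ), HasDerivAt (fun s : ℝ => (s ^ 2 / 2) • c) (s • c) s := fun c s => by
    simpa using ((hasDerivAt_pow 2 s).div_const 2).smul_const c
  have h₁ := norm_le_pow_succ_of_norm_deriv_le_pow (b := b) (C := M) (n := 0)
    (f := fun s => deriv (deriv u) (t - s) - deriv (deriv u) t) (by simp)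
    (fun s => (hcomp hu'' s).sub_const _)
    (fun s hs => by
      simpa using hM (t - s) ⟨by linarith [hs.2], by linarith [hs.1]⟩)
  have h₂ := norm_le_pow_succ_of_norm_deriv_le_pow (b := b) (C := M) (n := 1)
    (f := fun s => deriv u (t - s) - deriv u t + s • deriv (deriv u) t) (by simp)
    (fun s => ((hcomp hu' s).sub_const _).add (hid _ s))
    (fun s hs => by
      rw [neg_add_eq_sub, norm_sub_rev]
      simpa using h₁ s hs)
  have h₃ := norm_le_pow_succ_of_norm_deriv_le_pow (b := b) (C := M / 2) (n := 2)
    (f := fun s => u (t - s) - u t + s • deriv u t - (s ^ 2 / 2) • deriv (deriv u) t) (by simp)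
    (fun s => (((hcomp hu s).sub_const _).add (hid _ s)).sub (hsq _ s))
    (fun s hs => by
      have h := h₂ s hs
      norm_num at h
      rw [← norm_neg, neg_sub, neg_add_eq_sub, ← sub_add, add_comm, add_sub_left_comm,
        add_comm]
      exact h)
  intro s hs
  refine (h₃ s hs).trans_eq ?_
  push_cast
  ring

/-- Consistency of the BDF2 difference quotient: if `u : ℝ → X` is three times
differentiable and `‖u'''‖ ≤ M` on `[t − 2Δt, t]`, then
`‖u'(t) − (3u(t) − 4u(t − Δt) + u(t − 2Δt))/(2Δt)‖ ≤ M(Δt)²`. -/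
theorem stmt_9 {X : Type*} [NormedAddCommGroup X] [NormedSpace ℝ X]
    (u : ℝ → X) (hu : Differentiable ℝ u) (hu' : Differentiable ℝ (deriv u))
    (hu'' : Differentiable ℝ (deriv (deriv u)))
    (Δt t M : ℝ) (hΔt : 0 < Δt)
    (hM : ∀ s ∈ Set.Icc (t - 2 * Δt) t, ‖deriv (deriv (deriv u)) s‖ ≤ M) :
    ‖deriv u t - (2 * Δt)⁻¹ • ((3 : ℝ) • u t - (4 : ℝ) • u (t - Δt) + u (t - 2 * Δt))‖
      ≤ M * Δt ^ 2 := by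
  have hR := norm_backward_taylor_two_le hu hu' hu'' hM
  have h₁ := hR Δt ⟨hΔt.le, by linarith⟩
  have h₂ := hR (2 * Δt) ⟨by linarith, le_rfl⟩
  set R₁ := u (t - Δt) - u t + Δt • deriv u t - (Δt ^ 2 / 2) • deriv (deriv u) t with hR₁
  set R₂ := u (t - 2 * Δt) - u t + (2 * Δt) • deriv u t
    - ((2 * Δt) ^ 2 / 2) • deriv (deriv u) t with hR₂
  have key : deriv u t - (2 * Δt)⁻¹ • ((3 : ℝ) • u t - (4 : ℝ) • u (t - Δt) + u (t - 2 * Δt))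
      = (2 * Δt)⁻¹ • ((4 : ℝ) • R₁ - R₂) := by
    rw [hR₁, hR₂]
    match_scalars <;> field_simp <;> ring
  rw [key, norm_smul, Real.norm_of_nonneg (by positivity), inv_mul_le_iff₀ (by positivity)]
  calc ‖(4 : ℝ) • R₁ - R₂‖ ≤ ‖(4 : ℝ) • R₁‖ + ‖R₂‖ := norm_sub_le _ _
    _ = 4 * ‖R₁‖ + ‖R₂‖ := by rw [norm_smul, Real.norm_of_nonneg (by norm_num)]
    _ ≤ 4 * (M / 6 * Δt ^ 3) + M / 6 * (2 * Δt) ^ 3 := by gcongr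
    _ = 2 * Δt * (M * Δt ^ 2) := by ring
end
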